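/- In the minimum-counterexample setup, for every acyclic edge coloring c of G−xy using Δ+1 colors and every color γ ∈ C − F_x(c) (γ not appearing on any edge of G−xy incident with x), there exists a (μ,γ,xy)-critical path in G−xy with respect to c, where μ = c(y,y'). -/

import Mathlib

open SimpleGraph

namespace AEC

variable {V : Type*}

/-- The set of colors appearing (under partial coloring `c`) on colored edges incident
with the vertex `u` (i.e. `F_u`). -/
def colorsAt (G : SimpleGraph V) (c : Sym2 V → Option ℕ) (u : V) : Set ℕ :=
  {γ | ∃ z, G.Adj u z ∧ c s(u, z) = some γ}

/-- `S_ab`: the set of colors appearing on the colored edges incident with `b`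
other than the edge `ab`. -/
def Sset (G : SimpleGraph V) (c : Sym2 V → Option ℕ) (a b : V) : Set ℕ :=
  {γ | ∃ z, G.Adj b z ∧ z ≠ a ∧ c s(b, z) = some γ}

/-- A partial edge coloring (colors are `ℕ`, `none` = uncolored): it may only color
edges of `G`, and colored edges sharing an endpoint receive distinct colors. -/
def ProperPartialColoring (G : SimpleGraph V) (c : Sym2 V → Option ℕ) : Prop :=
  (∀ e, (c e).isSome → e ∈ G.edgeSet) ∧
  ∀ ⦃u v w : V⦄, G.Adj u v → G.Adj u w → v ≠ w → (c s(u, v)).isSome →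
    c s(u, v) ≠ c s(u, w)

/-- A valid (acyclic) partial coloring: proper, and no cycle of `G` is bichromatic,
i.e. no cycle has all of its edges colored using only two colors. -/
def AcyclicPartialColoring (G : SimpleGraph V) (c : Sym2 V → Option ℕ) : Prop :=
  ProperPartialColoring G c ∧
  ∀ (α β : ℕ) (v : V) (W : G.Walk v v), W.IsCycle →
    ¬ ∀ e ∈ W.edges, c e = some α ∨ c e = some β

/-- An acyclic edge coloring of `G` using (at most) `k` colors: a valid partial coloring
that colors every edge of `G` with a color `< k`. -/
def IsAcyclicEdgeColoring (G : SimpleGraph V) (k : ℕ) (c : Sym2 V → Option ℕ) : Prop :=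
  AcyclicPartialColoring G c ∧ ∀ e ∈ G.edgeSet, ∃ a, a < k ∧ c e = some a

/-- `G` is 2-degenerate: every nonempty (induced) subgraph has a vertex of degree at most 2. -/
def TwoDegenerate [DecidableEq V] (G : SimpleGraph V) [DecidableRel G.Adj] : Prop :=
  ∀ s : Finset V, s.Nonempty → ∃ v ∈ s, (s.filter fun u => G.Adj v u).card ≤ 2

/-- A maximal `(α,β)`-bichromatic path from `a` to `b`: a path all of whose edges are
colored `α` or `β`, which cannot be extended at either end. -/
def IsMaximalBichromaticPath (G : SimpleGraph V) (c : Sym2 V → Option ℕ)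
    (α β : ℕ) {a b : V} (W : G.Walk a b) : Prop :=
  W.IsPath ∧ (∀ e ∈ W.edges, c e = some α ∨ c e = some β) ∧
  (∀ w, G.Adj a w → (c s(a, w) = some α ∨ c s(a, w) = some β) → w ∈ W.support) ∧
  (∀ w, G.Adj b w → (c s(b, w) = some α ∨ c s(b, w) = some β) → w ∈ W.support)

/-- An `(α,β,a,b)`-maximal bichromatic path: a maximal `(α,β)`-bichromatic path from
`a` to `b` whose edge incident on `a` is colored `α`. -/
def IsMaxBichromaticPathFrom (G : SimpleGraph V) (c : Sym2 V → Option ℕ)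
    (α β : ℕ) {a b : V} (W : G.Walk a b) : Prop :=
  IsMaximalBichromaticPath G c α β W ∧ ∃ e, W.edges.head? = some e ∧ c e = some α

/-- An `(α,β,ab)`-critical path: a maximal `(α,β)`-bichromatic path from `a` to `b` whose
edges incident on `a` and on `b` are both colored `α`. -/
def IsCriticalPath (G : SimpleGraph V) (c : Sym2 V → Option ℕ)
    (α β : ℕ) {a b : V} (W : G.Walk a b) : Prop :=
  IsMaxBichromaticPathFrom G c α β W ∧ ∃ e, W.edges.getLast? = some e ∧ c e = some α

/-- `F''_x(c)`: colors of edges from `x` to its neighbors (other than `y`) of degree ≥ 3. -/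
def Fpp [Fintype V] (G : SimpleGraph V) [DecidableRel G.Adj]
    (c : Sym2 V → Option ℕ) (x y : V) : Set ℕ :=
  {γ | ∃ z, G.Adj x z ∧ z ≠ y ∧ 3 ≤ G.degree z ∧ c s(x, z) = some γ}

/-- `F'_x(c)`: colors of edges from `x` to its neighbors (other than `y`) of degree 2. -/
def Fp [Fintype V] (G : SimpleGraph V) [DecidableRel G.Adj]
    (c : Sym2 V → Option ℕ) (x y : V) : Set ℕ :=
  {γ | ∃ z, G.Adj x z ∧ z ≠ y ∧ G.degree z = 2 ∧ c s(x, z) = some γ}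

/-- `F_x(c) = F'_x(c) ∪ F''_x(c)`. -/
def Fx [Fintype V] (G : SimpleGraph V) [DecidableRel G.Adj]
    (c : Sym2 V → Option ℕ) (x y : V) : Set ℕ :=
  Fp G c x y ∪ Fpp G c x y

/-- The edges of a walk between distinct vertices start with an edge at its first vertex. -/
lemma exists_adj_edges_head? {G : SimpleGraph V} {u v : V} (W : G.Walk u v) (huv : u ≠ v) :
    ∃ w, G.Adj u w ∧ W.edges.head? = some s(u, w) := by
  cases W with
  | nil => exact absurd rfl huv
  | cons h p => exact ⟨_, h, rfl⟩

/-- The edges of a walk between distinct vertices end with an edge at its last vertex. -/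
lemma exists_adj_edges_getLast? {G : SimpleGraph V} {u v : V} (W : G.Walk u v) (huv : u ≠ v) :
    ∃ w, G.Adj v w ∧ W.edges.getLast? = some s(v, w) := by
  obtain ⟨w, hw, h⟩ := exists_adj_edges_head? W.reverse huv.symm
  refine ⟨w, hw, ?_⟩
  rwa [Walk.edges_reverse, List.head?_reverse] at h

/-- If every edge of a cycle satisfies `P`, then the endpoints of an edge of the cycle are joined
by a path avoiding that edge, all of whose edges satisfy `P`. -/
lemma exists_path_deleteEdges_of_isCycle {G : SimpleGraph V} {x y v : V} {W : G.Walk v v}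
    (hW : W.IsCycle) (hmem : s(x, y) ∈ W.edges) {P : Sym2 V → Prop} (hP : ∀ e ∈ W.edges, P e) :
    ∃ Q : (G.deleteEdges {s(x, y)}).Walk x y, Q.IsPath ∧ ∀ e ∈ Q.edges, P e := by
  classical
  let H : SimpleGraph V := G.deleteEdges {e | ¬ P e}
  have hH : ∀ e ∈ W.edges, e ∈ H.edgeSet := fun e he => by
    simpa [H, edgeSet_deleteEdges] using ⟨W.edges_subset_edgeSet he, hP e he⟩
  have hcyc := hW.transfer hH
  have hreach := (adj_and_reachable_delete_edges_iff_exists_cycle (G := H) (v := x) (w := y)).2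
    ⟨v, _, hcyc, by simpa using hmem⟩
  obtain ⟨Q, hQ⟩ := hreach.2.exists_isPath
  have hQe : ∀ e ∈ Q.edges, e ∈ G.edgeSet ∧ P e ∧ e ≠ s(x, y) := fun e he => by
    have h := Q.edges_subset_edgeSet he
    simp only [H, edgeSet_deleteEdges] at h
    exact ⟨h.1.1, not_not.1 h.1.2, h.2⟩
  have hQ' : ∀ e ∈ Q.edges, e ∈ (G.deleteEdges {s(x, y)}).edgeSet := fun e he => by
    rw [edgeSet_deleteEdges]
    exact ⟨(hQe e he).1, (hQe e he).2.2⟩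
  exact ⟨Q.transfer _ hQ', hQ.transfer hQ', fun e he => (hQe e (by simpa using he)).2.1⟩

/-- If `G` has no acyclic edge coloring with `k` colors and `c` is one of `G - xy`, then for every
color `γ` absent at both `x` and `y` some bichromatic path in `γ` and a second color joins
`x` to `y`. -/
lemma exists_bichromatic_path {G : SimpleGraph V} {k : ℕ}
    (hmin : ¬ ∃ c : Sym2 V → Option ℕ, IsAcyclicEdgeColoring G k c)
    {x y : V} (hxy : G.Adj x y) {c : Sym2 V → Option ℕ}
    (hc : IsAcyclicEdgeColoring (G.deleteEdges {s(x, y)}) k c) {γ : ℕ} (hγ : γ < k)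
    (hx : ∀ z, G.Adj x z → z ≠ y → c s(x, z) ≠ some γ)
    (hy : ∀ z, G.Adj y z → z ≠ x → c s(y, z) ≠ some γ) :
    ∃ (β : ℕ) (W : (G.deleteEdges {s(x, y)}).Walk x y),
      W.IsPath ∧ ∀ e ∈ W.edges, c e = some γ ∨ c e = some β := by
  classical
  by_contra! hno
  obtain ⟨⟨⟨hdom, hproper⟩, hacyc⟩, htot⟩ := hc
  set c' := Function.update c s(x, y) (some γ) with hc'
  have hself : c' s(x, y) = some γ := Function.update_self ..
  have hne : ∀ e, e ≠ s(x, y) → c' e = c e := fun e he => Function.update_of_ne he ..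
  have hat : ∀ u v w, s(u, v) = s(x, y) → G.Adj u w → v ≠ w → c' s(u, w) ≠ some γ := by
    intro u v w huv huw hvw
    have hw : s(u, w) ≠ s(x, y) := fun h => hvw (Sym2.congr_right.1 (huv.trans h.symm))
    rw [hne _ hw]
    rcases Sym2.eq_iff.1 huv with ⟨rfl, rfl⟩ | ⟨rfl, rfl⟩
    · exact hx w huw hvw.symm
    · exact hy w huw hvw.symm
  refine hmin ⟨c', ⟨⟨fun e he => ?_, fun u v w huv huw hvw hs => ?_⟩, fun α β v W hW hcol => ?_⟩,
    fun e he => ?_⟩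
  · by_cases h : e = s(x, y)
    · exact h ▸ hxy
    · rw [hne e h] at he
      exact edgeSet_mono (deleteEdges_le _) (hdom e he)
  · by_cases h1 : s(u, v) = s(x, y)
    · rw [h1, hself]
      exact (hat u v w h1 huw hvw).symm
    by_cases h2 : s(u, w) = s(x, y)
    · rw [h2, hself]
      exact hat u w v h2 huv hvw.symm
    rw [hne _ h1] at hs ⊢
    rw [hne _ h2]
    exact hproper (deleteEdges_adj.2 ⟨huv, h1⟩) (deleteEdges_adj.2 ⟨huw, h2⟩) hvw hs
  · by_cases hmem : s(x, y) ∈ W.edges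
    · obtain ⟨Q, hQ, hQc⟩ := exists_path_deleteEdges_of_isCycle hW hmem hcol
      have hQ' : ∀ e ∈ Q.edges, c e = some α ∨ c e = some β := fun e he => by
        have h := Q.edges_subset_edgeSet he
        rw [edgeSet_deleteEdges] at h
        rw [← hne e h.2]
        exact hQc e he
      have hγ' := hcol _ hmem
      rw [hself, Option.some_inj, Option.some_inj] at hγ'
      rcases hγ' with rfl | rfl
      · obtain ⟨e, he, h1, h2⟩ := hno β Q hQ
        exact (hQ' e he).elim h1 h2
      · obtain ⟨e, he, h1, h2⟩ := hno α Q hQ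
        exact (hQ' e he).elim h2 h1
    · have hne' : ∀ e ∈ W.edges, e ≠ s(x, y) := fun e he h => hmem (h ▸ he)
      have hW' : ∀ e ∈ W.edges, e ∈ (G.deleteEdges {s(x, y)}).edgeSet := fun e he => by
        rw [edgeSet_deleteEdges]
        exact ⟨W.edges_subset_edgeSet he, hne' e he⟩
      refine hacyc α β v _ (hW.transfer hW') fun e he => ?_
      rw [Walk.edges_transfer] at he
      rw [← hne e (hne' e he)]
      exact hcol e he
  · by_cases h : e = s(x, y)
    · exact ⟨γ, hγ, h ▸ hself⟩
    · rw [hne e h]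
      exact htot e (by rw [edgeSet_deleteEdges]; exact ⟨he, h⟩)

/-- Among `Δ + 1` colors, some color other than `a` is absent on the edges at `x`
other than `xy`. -/
lemma exists_free_color [Fintype V] (G : SimpleGraph V) [DecidableRel G.Adj]
    (c : Sym2 V → Option ℕ) {x y : V} (hxy : G.Adj x y) (a : ℕ) :
    ∃ γ < G.maxDegree + 1, γ ≠ a ∧ ∀ z, G.Adj x z → z ≠ y → c s(x, z) ≠ some γ := by
  classical
  let S := ((G.neighborFinset x).erase y).image fun z => (c s(x, z)).getD 0
  have hmem : y ∈ G.neighborFinset x := (G.mem_neighborFinset x y).2 hxy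
  have h1 : S.card ≤ G.degree x - 1 :=
    Finset.card_image_le.trans (by rw [Finset.card_erase_of_mem hmem, card_neighborFinset_eq_degree])
  have h2 : 0 < G.degree x := (G.degree_pos_iff_exists_adj x).2 ⟨y, hxy⟩
  have h3 := G.degree_le_maxDegree x
  have h4 := Finset.card_insert_le a S
  obtain ⟨γ, hγ, hγS⟩ := Finset.exists_mem_notMem_of_card_lt_card
    (s := insert a S) (t := Finset.range (G.maxDegree + 1)) (by rw [Finset.card_range]; lia)
  rw [Finset.mem_insert, not_or] at hγS
  refine ⟨γ, Finset.mem_range.1 hγ, hγS.1, fun z hz hzy hcz => hγS.2 ?_⟩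
  exact Finset.mem_image.2 ⟨z, by simp [hz, hzy], by simp [hcz]⟩

/-- If `G` has no acyclic edge coloring with `Δ + 1` colors but every `G - e` has one, then
every neighbor of a vertex has degree at least two. -/
lemma two_le_degree_of_adj [Fintype V] {G : SimpleGraph V} [DecidableRel G.Adj]
    (hmin : ¬ ∃ c : Sym2 V → Option ℕ, IsAcyclicEdgeColoring G (G.maxDegree + 1) c)
    (hdel : ∀ e ∈ G.edgeSet, ∃ c : Sym2 V → Option ℕ,
      IsAcyclicEdgeColoring (G.deleteEdges {e}) (G.maxDegree + 1) c)
    {x z : V} (hxz : G.Adj x z) : 2 ≤ G.degree z := by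
  by_contra! hlt
  have huniq : ∀ w, G.Adj z w → w = x := fun w hw =>
    Finset.card_le_one.1 (Nat.le_of_lt_succ hlt) w (by simpa using hw) x (by simpa using hxz.symm)
  obtain ⟨c, hc⟩ := hdel s(x, z) hxz
  obtain ⟨γ, hγ, -, hγx⟩ := exists_free_color G c hxz 0
  obtain ⟨-, W, -⟩ := exists_bichromatic_path hmin hxz hc hγ hγx
    fun w hw hwx => absurd (huniq w hw) hwx
  obtain ⟨w, hw, -⟩ := exists_adj_edges_getLast? W hxz.ne
  rw [deleteEdges_adj] at hw
  exact hw.2 (by rw [huniq w hw.1, Sym2.eq_swap]; rfl)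

/-- Lemma 5: in the minimum-counterexample setup, for every color
`γ ∈ C − F_x(c)` there exists a `(μ,γ,xy)`-critical path in `G − xy` with respect to
`c`, where `μ = c(y,y')`. -/
theorem criticalPath_of_not_mem_Fx
    {V : Type*} [Fintype V] [DecidableEq V] (G : SimpleGraph V) [DecidableRel G.Adj]
    (h2deg : TwoDegenerate G)
    (hmin : ¬ ∃ c : Sym2 V → Option ℕ, IsAcyclicEdgeColoring G (G.maxDegree + 1) c)
    (hdel : ∀ e ∈ G.edgeSet, ∃ c : Sym2 V → Option ℕ,
      IsAcyclicEdgeColoring (G.deleteEdges {e}) (G.maxDegree + 1) c)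
    (x : V)
    (hxdeg2 : ∃ z, G.Adj x z ∧ G.degree z = 2)
    (hxdeg3 : ((G.neighborFinset x).filter fun z => 3 ≤ G.degree z).card ≤ 2)
    (y y' : V) (hxy : G.Adj x y) (hy2 : G.degree y = 2)
    (hyy' : G.Adj y y') (hy'x : y' ≠ x)
    (c : Sym2 V → Option ℕ)
    (hc : IsAcyclicEdgeColoring (G.deleteEdges {s(x, y)}) (G.maxDegree + 1) c)
    (μ γ : ℕ) (hμ : c s(y, y') = some μ)
    (hγC : γ < G.maxDegree + 1) (hγF : γ ∉ Fx G c x y) :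
    ∃ W : (G.deleteEdges {s(x, y)}).Walk x y,
      IsCriticalPath (G.deleteEdges {s(x, y)}) c μ γ W := by
  have hγx : ∀ z, G.Adj x z → z ≠ y → c s(x, z) ≠ some γ := fun z hz hzy hcz => by
    rcases (two_le_degree_of_adj hmin hdel hz).eq_or_lt with h | h
    · exact hγF (Or.inl ⟨z, hz, hzy, h.symm, hcz⟩)
    · exact hγF (Or.inr ⟨z, hz, hzy, h, hcz⟩)
  have hNy : ∀ w, G.Adj y w → w ≠ x → w = y' := fun w hw hwx => by
    by_contra hwy'
    have hsub : ({x, y', w} : Finset V) ⊆ G.neighborFinset y := by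
      simp [Finset.insert_subset_iff, hxy.symm, hyy', hw]
    have h := Finset.card_le_card hsub
    rw [card_neighborFinset_eq_degree, hy2,
      Finset.card_eq_three.2 ⟨x, y', w, hy'x.symm, Ne.symm hwx, Ne.symm hwy', rfl⟩] at h
    lia
  have hdel_x : ∀ w, (G.deleteEdges {s(x, y)}).Adj x w → G.Adj x w ∧ w ≠ y := fun w hw => by
    rw [deleteEdges_adj] at hw
    exact ⟨hw.1, fun h => hw.2 (by rw [h]; rfl)⟩
  have hdel_y : ∀ w, (G.deleteEdges {s(x, y)}).Adj y w → w = y' := fun w hw => by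
    rw [deleteEdges_adj] at hw
    exact hNy w hw.1 fun h => hw.2 (by rw [h, Sym2.eq_swap]; rfl)
  have key : ∀ δ < G.maxDegree + 1, δ ≠ μ → (∀ z, G.Adj x z → z ≠ y → c s(x, z) ≠ some δ) →
      ∃ W : (G.deleteEdges {s(x, y)}).Walk x y,
        W.IsPath ∧ ∀ e ∈ W.edges, c e = some δ ∨ c e = some μ := by
    intro δ hδ hδμ hδx
    obtain ⟨β, W, hW, hcol⟩ := exists_bichromatic_path hmin hxy hc hδ hδx fun z hz hzx => by
      rw [hNy z hz hzx, hμ]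
      exact fun h => hδμ (Option.some_inj.1 h).symm
    obtain ⟨w, hw, hlast⟩ := exists_adj_edges_getLast? W hxy.ne
    have h := hcol _ (List.mem_of_getLast? hlast)
    rw [hdel_y w hw, hμ, Option.some_inj, Option.some_inj] at h
    obtain rfl := h.resolve_left (Ne.symm hδμ)
    exact ⟨W, hW, hcol⟩
  have hγμ : γ ≠ μ := by
    rintro rfl
    obtain ⟨δ, hδ, hδγ, hδx⟩ := exists_free_color G c hxy γ
    obtain ⟨W, -, hcol⟩ := key δ hδ hδγ hδx
    obtain ⟨w, hw, hhead⟩ := exists_adj_edges_head? W hxy.ne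
    obtain ⟨hxw, hwy⟩ := hdel_x w hw
    exact (hcol _ (List.mem_of_head? hhead)).elim (hδx w hxw hwy) (hγx w hxw hwy)
  obtain ⟨W, hW, hcol⟩ := key γ hγC hγμ hγx
  obtain ⟨v, hv, hhead⟩ := exists_adj_edges_head? W hxy.ne
  obtain ⟨u, hu, hlast⟩ := exists_adj_edges_getLast? W hxy.ne
  have hcv : c s(x, v) = some μ :=
    (hcol _ (List.mem_of_head? hhead)).resolve_left (hγx v (hdel_x v hv).1 (hdel_x v hv).2)
  refine ⟨W, ⟨⟨hW, fun e he => (hcol e he).symm, fun w hw hcw => ?_, fun w hw _ => ?_⟩,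
    _, hhead, hcv⟩, _, hlast, by rw [hdel_y u hu, hμ]⟩
  · have hcw' := hcw.resolve_right (hγx w (hdel_x w hw).1 (hdel_x w hw).2)
    have hvw : v = w := by
      by_contra hvw
      exact hc.1.1.2 hv hw hvw (by rw [hcv]; rfl) (hcv.trans hcw'.symm)
    exact hvw ▸ W.snd_mem_support_of_mem_edges (List.mem_of_head? hhead)
  · rw [hdel_y w hw, ← hdel_y u hu]
    exact W.snd_mem_support_of_mem_edges (List.mem_of_getLast? hlast)

end AEC
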